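/- arXiv:1312.0345 — 2 statements merged into one kernel-verified Lean document; each statement's English description precedes it below -/
import Mathlib

section
/- If γ is an optimal transfer plan between μ₀ and μ₁ and (φ₀,φ₁) is an optimal Kantorovich pair, then the support of γ is contained in the set { (x,y) ∈ M × M : φ₁(y) − φ₀(x) = c(x,y) }. -/
open MeasureTheory Set

noncomputable section

/-- A transport plan between `μ₀` and `μ₁`. -/
def IsPlan {M : Type*} [MeasurableSpace M] (μ₀ μ₁ : Measure M)
    (γ : Measure (M × M)) : Prop :=
  IsProbabilityMeasure γ ∧ γ.map Prod.fst = μ₀ ∧ γ.map Prod.snd = μ₁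

/-- An admissible Kantorovich pair for the cost `c`. -/
def IsAdmPair {M : Type*} (c : M → M → ℝ) (φ₀ φ₁ : M → ℝ)
    [TopologicalSpace M] : Prop :=
  Continuous φ₀ ∧ Continuous φ₁ ∧
    (∀ y, IsLeast { r | ∃ x, r = φ₀ x + c x y } (φ₁ y)) ∧
    (∀ x, IsGreatest { r | ∃ y, r = φ₁ y - c x y } (φ₀ x))

/-- The (topological) support of a measure: the set of points all of whose
neighbourhoods have positive measure. -/
def msupport {X : Type*} [TopologicalSpace X] [MeasurableSpace X]
    (μ : Measure X) : Set X :=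
  { x | ∀ s ∈ nhds x, μ s ≠ 0 }

/-- A sublinear functional on a real vector space is attained at any given vector by a linear
functional it dominates. -/
theorem exists_linearMap_le_sublinear_eq_apply {E : Type*} [AddCommGroup E] [Module ℝ E]
    (N : E → ℝ) (N_hom : ∀ t : ℝ, 0 < t → ∀ x, N (t • x) = t * N x)
    (N_add : ∀ x y, N (x + y) ≤ N x + N y) (x : E) :
    ∃ g : E →ₗ[ℝ] ℝ, g x = N x ∧ ∀ y, g y ≤ N y := by
  have N_zero : N 0 = 0 := by
    have := N_hom 2 (by norm_num) 0
    rw [smul_zero] at this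
    linarith
  have H : ∀ t : ℝ, t • x = 0 → (RingHom.id ℝ) t • N x = 0 := by
    intro t ht
    rcases smul_eq_zero.1 ht with rfl | rfl <;> simp [N_zero]
  obtain ⟨g, hg, hgN⟩ := exists_extension_of_le_sublinear
    (LinearPMap.mkSpanSingleton' x (N x) H) N N_hom N_add (by
      rintro ⟨y, hy⟩
      obtain ⟨t, rfl⟩ := Submodule.mem_span_singleton.1 hy
      rw [LinearPMap.mkSpanSingleton'_apply]
      change t * N x ≤ N (t • x)
      rcases lt_trichotomy t 0 with ht | rfl | ht
      · have h₁ := N_add (t • x) ((-t) • x)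
        rw [N_hom (-t) (by linarith), ← add_smul, add_neg_cancel, zero_smul, N_zero] at h₁
        linarith
      · simp [N_zero]
      · rw [N_hom t ht])
  refine ⟨g, ?_, hgN⟩
  rw [← LinearPMap.mkSpanSingleton'_apply_self x (N x) H (Submodule.mem_span_singleton_self x)]
  exact hg ⟨x, Submodule.mem_span_singleton_self x⟩

/-- The **Riesz–Markov–Kakutani theorem** on a compact Hausdorff space. -/
theorem exists_isFiniteMeasure_integral_eq {X : Type*} [TopologicalSpace X] [CompactSpace X]
    [T2Space X] [MeasurableSpace X] [BorelSpace X] (L : C(X, ℝ) →ₗ[ℝ] ℝ)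
    (hL : ∀ f : C(X, ℝ), 0 ≤ f → 0 ≤ L f) :
    ∃ μ : Measure X, IsFiniteMeasure μ ∧ ∀ f : C(X, ℝ), ∫ x, f x ∂μ = L f := by
  let Λ : CompactlySupportedContinuousMap X ℝ →ₚ[ℝ] ℝ := PositiveLinearMap.mk₀
    { toFun := fun f => L f.toContinuousMap
      map_add' := fun f g => L.map_add f.toContinuousMap g.toContinuousMap
      map_smul' := fun t f => L.map_smul t f.toContinuousMap }
    (fun f hf => hL f.toContinuousMap hf)
  refine ⟨RealRMK.rieszMeasure Λ, inferInstance, fun f => ?_⟩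
  exact RealRMK.integral_rieszMeasure Λ (CompactlySupportedContinuousMap.continuousMapEquiv f)

theorem Continuous.integrable_of_compactSpace {X : Type*} [TopologicalSpace X] [CompactSpace X]
    [MeasurableSpace X] [OpensMeasurableSpace X] {μ : Measure X} [IsFiniteMeasure μ]
    {f : X → ℝ} (hf : Continuous f) : Integrable f μ :=
  hf.integrable_of_hasCompactSupport (HasCompactSupport.of_compactSpace f)

section Kantorovich

variable {M : Type*} [MetricSpace M] [CompactSpace M] [MeasurableSpace M] [BorelSpace M]

theorem IsPlan.integral_add {μ₀ μ₁ : Measure M} {γ : Measure (M × M)} (hγ : IsPlan μ₀ μ₁ γ)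
    {a b : M → ℝ} (ha : Continuous a) (hb : Continuous b) :
    ∫ p, a p.1 + b p.2 ∂γ = ∫ x, a x ∂μ₀ + ∫ y, b y ∂μ₁ := by
  obtain ⟨_, rfl, rfl⟩ := hγ
  rw [MeasureTheory.integral_add (μ := γ) (f := fun p : M × M => a p.1)
      (g := fun p : M × M => b p.2)
      (ha.comp continuous_fst).integrable_of_compactSpace
      (hb.comp continuous_snd).integrable_of_compactSpace,
    integral_map measurable_fst.aemeasurable ha.aestronglyMeasurable,
    integral_map measurable_snd.aemeasurable hb.aestronglyMeasurable]

/-- The values `∫ a dμ₀ + ∫ b dμ₁` over continuous `a`, `b` with `f(x, y) ≤ a(x) + b(y)`. -/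
def dualValues (μ₀ μ₁ : Measure M) (f : C(M × M, ℝ)) : Set ℝ :=
  { r | ∃ a b : C(M, ℝ), (∀ x y, f (x, y) ≤ a x + b y) ∧ r = ∫ x, a x ∂μ₀ + ∫ y, b y ∂μ₁ }

omit [BorelSpace M] in
theorem dualValues_nonempty (μ₀ μ₁ : Measure M) (f : C(M × M, ℝ)) :
    (dualValues μ₀ μ₁ f).Nonempty :=
  ⟨_, ContinuousMap.const M ‖f‖, 0, fun x y => by
    simpa using (le_abs_self _).trans (f.norm_coe_le_norm (x, y)), rfl⟩

theorem dualValues_bddBelow {μ₀ μ₁ : Measure M} {γ : Measure (M × M)} (hγ : IsPlan μ₀ μ₁ γ)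
    (f : C(M × M, ℝ)) : BddBelow (dualValues μ₀ μ₁ f) := by
  refine ⟨∫ p, f p ∂γ, ?_⟩
  rintro _ ⟨a, b, hab, rfl⟩
  have := hγ.1
  rw [← hγ.integral_add a.continuous b.continuous]
  exact integral_mono f.continuous.integrable_of_compactSpace
    (Continuous.integrable_of_compactSpace (by fun_prop)) fun p => hab p.1 p.2

omit [CompactSpace M] [BorelSpace M] in
open scoped Pointwise in
theorem dualValues_smul (μ₀ μ₁ : Measure M) {t : ℝ} (ht : 0 < t) (f : C(M × M, ℝ)) :
    dualValues μ₀ μ₁ (t • f) = t • dualValues μ₀ μ₁ f := by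
  have key : ∀ {s : ℝ}, 0 < s → ∀ g : C(M × M, ℝ),
      s • dualValues μ₀ μ₁ g ⊆ dualValues μ₀ μ₁ (s • g) := by
    rintro s hs g _ ⟨_, ⟨a, b, hab, rfl⟩, rfl⟩
    refine ⟨s • a, s • b, fun x y => ?_, ?_⟩
    · simpa [mul_add] using mul_le_mul_of_nonneg_left (hab x y) hs.le
    · simp [integral_const_mul, mul_add]
  refine Subset.antisymm ?_ (key ht f)
  have := key (inv_pos.2 ht) (t • f)
  rw [inv_smul_smul₀ ht.ne'] at this
  exact (Set.subset_smul_set_iff₀ ht.ne').2 this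

open scoped Pointwise in
theorem dualValues_add_subset (μ₀ μ₁ : Measure M) [IsFiniteMeasure μ₀] [IsFiniteMeasure μ₁]
    (f g : C(M × M, ℝ)) :
    dualValues μ₀ μ₁ f + dualValues μ₀ μ₁ g ⊆ dualValues μ₀ μ₁ (f + g) := by
  rintro _ ⟨_, ⟨a, b, hab, rfl⟩, _, ⟨a', b', hab', rfl⟩, rfl⟩
  refine ⟨a + a', b + b', fun x y => ?_, ?_⟩
  · have h₁ := hab x y
    have h₂ := hab' x y
    simp only [ContinuousMap.add_apply]
    linarith
  · simp only [ContinuousMap.add_apply]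
    rw [MeasureTheory.integral_add a.continuous.integrable_of_compactSpace
        a'.continuous.integrable_of_compactSpace,
      MeasureTheory.integral_add b.continuous.integrable_of_compactSpace
        b'.continuous.integrable_of_compactSpace]
    ring

/-- Kantorovich duality: some transport plan attains the dual value. -/
theorem exists_isPlan_integral_eq_sInf_dualValues {μ₀ μ₁ : Measure M} [IsProbabilityMeasure μ₀]
    [IsProbabilityMeasure μ₁] {γ : Measure (M × M)} (hγ : IsPlan μ₀ μ₁ γ) (f : C(M × M, ℝ)) :
    ∃ γ', IsPlan μ₀ μ₁ γ' ∧ ∫ p, f p ∂γ' = sInf (dualValues μ₀ μ₁ f) := by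
  obtain ⟨L, hLf, hL⟩ := exists_linearMap_le_sublinear_eq_apply
    (fun g => sInf (dualValues μ₀ μ₁ g))
    (fun t ht g => by
      rw [dualValues_smul μ₀ μ₁ ht, Real.sInf_smul_of_nonneg ht.le, smul_eq_mul])
    (fun g h => by
      rw [← csInf_add (dualValues_nonempty μ₀ μ₁ g) (dualValues_bddBelow hγ g)
        (dualValues_nonempty μ₀ μ₁ h) (dualValues_bddBelow hγ h)]
      exact csInf_le_csInf (dualValues_bddBelow hγ _)
        ((dualValues_nonempty μ₀ μ₁ g).add (dualValues_nonempty μ₀ μ₁ h))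
        (dualValues_add_subset μ₀ μ₁ g h)) f
  have hLle : ∀ (g : C(M × M, ℝ)) (a b : C(M, ℝ)), (∀ x y, g (x, y) ≤ a x + b y) →
      L g ≤ ∫ x, a x ∂μ₀ + ∫ y, b y ∂μ₁ := fun g a b h =>
    (hL g).trans (csInf_le (dualValues_bddBelow hγ g) ⟨a, b, h, rfl⟩)
  have hLeq : ∀ (g : C(M × M, ℝ)) (a b : C(M, ℝ)), (∀ x y, g (x, y) = a x + b y) →
      L g = ∫ x, a x ∂μ₀ + ∫ y, b y ∂μ₁ := by
    intro g a b h
    refine le_antisymm (hLle g a b fun x y => (h x y).le) ?_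
    have := hLle (-g) (-a) (-b) fun x y => by
      simp only [ContinuousMap.neg_apply, h]
      linarith
    simp only [map_neg, ContinuousMap.neg_apply, integral_neg] at this
    linarith
  obtain ⟨γ', hfin, hγ'⟩ := exists_isFiniteMeasure_integral_eq L fun g hg => by
    have := hLle (-g) 0 0 fun x y => by simpa using hg (x, y)
    simpa using this
  have h₀ : γ'.map Prod.fst = μ₀ := by
    refine ext_of_forall_integral_eq_of_IsFiniteMeasure fun g => ?_
    rw [integral_map measurable_fst.aemeasurable g.continuous.aestronglyMeasurable]
    have := hLeq (g.toContinuousMap.comp ContinuousMap.fst) g.toContinuousMap 0 (by simp)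
    rw [← hγ'] at this
    simpa using this
  have h₁ : γ'.map Prod.snd = μ₁ := by
    refine ext_of_forall_integral_eq_of_IsFiniteMeasure fun g => ?_
    rw [integral_map measurable_snd.aemeasurable g.continuous.aestronglyMeasurable]
    have := hLeq (g.toContinuousMap.comp ContinuousMap.snd) 0 g.toContinuousMap (by simp)
    rw [← hγ'] at this
    simpa using this
  refine ⟨γ', ⟨⟨?_⟩, h₀, h₁⟩, (hγ' f).trans hLf⟩
  rw [← Set.preimage_univ (f := Prod.fst), ← Measure.map_apply measurable_fst .univ, h₀,
    measure_univ]

omit [MeasurableSpace M] [BorelSpace M] in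
/-- The infimum of a continuous function of two variables over the first one is attained and
depends continuously on the second one. -/
theorem exists_continuous_isLeast [Nonempty M] {h : M → M → ℝ}
    (hh : Continuous fun p : M × M => h p.1 p.2) :
    ∃ m : M → ℝ, Continuous m ∧ ∀ y, IsLeast { r | ∃ x, r = h x y } (m y) := by
  refine ⟨fun y => sInf ((fun x => h x y) '' univ),
    isCompact_univ.continuous_sInf (f := fun y x => h x y) (hh.comp continuous_swap),
    fun y => ?_⟩
  have hset : { r | ∃ x, r = h x y } = (fun x => h x y) '' univ := by
    ext r
    simp [eq_comm]
  rw [hset]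
  exact (isCompact_univ.image (hh.comp (.prodMk continuous_id continuous_const))).isLeast_sInf
    (univ_nonempty.image _)

omit [MeasurableSpace M] [BorelSpace M] in
/-- Every pair of continuous functions feasible for the dual problem is improved by an admissible
pair. -/
theorem exists_isAdmPair_of_le [Nonempty M] {c : M → M → ℝ}
    (hc : Continuous fun p : M × M => c p.1 p.2) {a b : M → ℝ} (ha : Continuous a)
    (hab : ∀ x y, b y ≤ a x + c x y) :
    ∃ ψ₀ ψ₁, IsAdmPair c ψ₀ ψ₁ ∧ ψ₀ ≤ a ∧ b ≤ ψ₁ := by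
  obtain ⟨ψ₁, hψ₁, hleast⟩ := exists_continuous_isLeast (h := fun x y => a x + c x y)
    ((ha.comp continuous_fst).add hc)
  obtain ⟨m, hm, hmleast⟩ := exists_continuous_isLeast (h := fun y x => c x y - ψ₁ y)
    ((hc.comp continuous_swap).sub (hψ₁.comp continuous_fst))
  have hgreatest : ∀ x, IsGreatest { r | ∃ y, r = ψ₁ y - c x y } (-m x) := by
    refine fun x => ⟨?_, ?_⟩
    · obtain ⟨y, hy⟩ := (hmleast x).1
      exact ⟨y, by linarith⟩
    · rintro _ ⟨y, rfl⟩
      have : m x ≤ c x y - ψ₁ y := (hmleast x).2 ⟨y, rfl⟩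
      linarith
  have hma : ∀ x, -m x ≤ a x := by
    intro x
    obtain ⟨y, hy⟩ := (hgreatest x).1
    have : ψ₁ y ≤ a x + c x y := (hleast y).2 ⟨x, rfl⟩
    linarith
  refine ⟨fun x => -m x, ψ₁, ⟨hm.neg, hψ₁, fun y => ⟨?_, ?_⟩, hgreatest⟩, hma, fun y => ?_⟩
  · obtain ⟨x, hx⟩ := (hleast y).1
    refine ⟨x, ?_⟩
    have h₁ : ψ₁ y - c x y ≤ -m x := (hgreatest x).2 ⟨y, rfl⟩
    have h₂ := hma x
    linarith
  · rintro _ ⟨x, rfl⟩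
    have : ψ₁ y - c x y ≤ -m x := (hgreatest x).2 ⟨y, rfl⟩
    linarith
  · obtain ⟨x, hx⟩ := (hleast y).1
    rw [hx]
    exact hab x y

end Kantorovich

/-- A nonnegative continuous function with nonpositive integral vanishes on the support. -/
theorem eq_zero_of_mem_msupport {X : Type*} [TopologicalSpace X] [MeasurableSpace X]
    {μ : Measure X} {f : X → ℝ} (hf : Continuous f) (hint : Integrable f μ)
    (hnonneg : 0 ≤ f) (hle : ∫ x, f x ∂μ ≤ 0) {x : X} (hx : x ∈ msupport μ) : f x = 0 := by
  by_contra hne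
  have hae := (integral_eq_zero_iff_of_nonneg hnonneg hint).1
    (le_antisymm hle (integral_nonneg hnonneg))
  exact hx {z | f z ≠ 0} ((isOpen_ne.preimage hf).mem_nhds hne) (ae_iff.1 hae)

/-- The support of an optimal transfer plan is contained in the set where an
optimal Kantorovich pair realizes the cost. -/
theorem support_of_optimal_plan {M : Type*} [MetricSpace M] [CompactSpace M]
    [Nonempty M] [MeasurableSpace M] [BorelSpace M]
    (c : M → M → ℝ) (hc : Continuous fun p : M × M => c p.1 p.2)
    (μ₀ μ₁ : Measure M) [IsProbabilityMeasure μ₀] [IsProbabilityMeasure μ₁]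
    (γ : Measure (M × M)) (hγ : IsPlan μ₀ μ₁ γ)
    (hγopt : ∀ γ' : Measure (M × M), IsPlan μ₀ μ₁ γ' →
      (∫ p, c p.1 p.2 ∂γ) ≤ ∫ p, c p.1 p.2 ∂γ')
    (φ₀ φ₁ : M → ℝ) (hφ : IsAdmPair c φ₀ φ₁)
    (hφopt : ∀ ψ₀ ψ₁ : M → ℝ, IsAdmPair c ψ₀ ψ₁ →
      (∫ y, ψ₁ y ∂μ₁) - (∫ x, ψ₀ x ∂μ₀) ≤
        (∫ y, φ₁ y ∂μ₁) - ∫ x, φ₀ x ∂μ₀) :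
    msupport γ ⊆ { p : M × M | φ₁ p.2 - φ₀ p.1 = c p.1 p.2 } := by
  have hprob := hγ.1
  obtain ⟨hφ₀, hφ₁, hleast, -⟩ := hφ
  obtain ⟨γ', hplan, hcost⟩ := exists_isPlan_integral_eq_sInf_dualValues hγ
    (-⟨fun p : M × M => c p.1 p.2, hc⟩ : C(M × M, ℝ))
  have hdual : (∫ x, φ₀ x ∂μ₀) - ∫ y, φ₁ y ∂μ₁ ≤ ∫ p, -c p.1 p.2 ∂γ' := by
    refine le_of_le_of_eq (le_csInf (dualValues_nonempty _ _ _) ?_) hcost.symm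
    rintro _ ⟨a, b, hab, rfl⟩
    obtain ⟨ψ₀, ψ₁, hψ, hle₀, hle₁⟩ := exists_isAdmPair_of_le hc (b := fun y => -b y)
      a.continuous fun x y => by
        have : -c x y ≤ a x + b y := hab x y
        linarith
    have hopt := hφopt ψ₀ ψ₁ hψ
    have h₀ : ∫ x, ψ₀ x ∂μ₀ ≤ ∫ x, a x ∂μ₀ := integral_mono
      hψ.1.integrable_of_compactSpace a.continuous.integrable_of_compactSpace hle₀
    have h₁ : ∫ y, -b y ∂μ₁ ≤ ∫ y, ψ₁ y ∂μ₁ := integral_mono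
      b.continuous.neg.integrable_of_compactSpace hψ.2.1.integrable_of_compactSpace hle₁
    rw [integral_neg] at h₁
    linarith
  rw [integral_neg] at hdual
  have hsum := hγ.integral_add (b := fun y => -φ₁ y) hφ₀ hφ₁.neg
  rw [integral_neg] at hsum
  have hcont : Continuous fun p : M × M => φ₀ p.1 + -φ₁ p.2 := by fun_prop
  intro p hp
  have hzero := eq_zero_of_mem_msupport (f := fun p : M × M => c p.1 p.2 + (φ₀ p.1 + -φ₁ p.2))
    (hc.add hcont) (hc.add hcont).integrable_of_compactSpace
    (fun p => by
      have : φ₁ p.2 ≤ φ₀ p.1 + c p.1 p.2 := (hleast p.2).2 ⟨p.1, rfl⟩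
      change 0 ≤ c p.1 p.2 + (φ₀ p.1 + -φ₁ p.2)
      linarith)
    (by
      rw [integral_add hc.integrable_of_compactSpace hcont.integrable_of_compactSpace, hsum]
      linarith [hγopt γ' hplan]) hp
  change φ₁ p.2 - φ₀ p.1 = c p.1 p.2
  linarith
end
end

section
/- (Existence of an optimal transfer plan) Let M be a compact metric space, c : M × M → ℝ continuous, and μ₀, μ₁ Borel probability measures on M. Then the set of transport plans K(μ₀,μ₁) is nonempty (it contains the product measure μ₀ × μ₁), and the infimum of γ ↦ ∫_{M×M} c dγ over K(μ₀,μ₁) is attained by some transport plan. -/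
open MeasureTheory Set

noncomputable section

/-- Total cost against a continuous cost function is continuous for weak convergence. -/
theorem continuous_integral_probabilityMeasure {X : Type*} [TopologicalSpace X]
    [CompactSpace X] [MeasurableSpace X] [OpensMeasurableSpace X]
    {f : X → ℝ} (hf : Continuous f) :
    Continuous fun γ : ProbabilityMeasure X => ∫ x, f x ∂(γ : Measure X) :=
  ProbabilityMeasure.continuous_integral_continuousMap (⟨f, hf⟩ : C(X, ℝ))

/-- The product measure is a transport plan. -/
theorem isPlan_prod {M : Type*} [MeasurableSpace M] (μ₀ μ₁ : Measure M)
    [IsProbabilityMeasure μ₀] [IsProbabilityMeasure μ₁] :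
    IsPlan μ₀ μ₁ (μ₀.prod μ₁) :=
  ⟨inferInstance, by simp [Measure.map_fst_prod], by simp [Measure.map_snd_prod]⟩

/-- On a compact metric space, transport plans form a weakly compact set. -/
theorem isCompact_setOf_isPlan {M : Type*} [MetricSpace M] [CompactSpace M]
    [MeasurableSpace M] [BorelSpace M] (μ₀ μ₁ : Measure M)
    [IsProbabilityMeasure μ₀] [IsProbabilityMeasure μ₁] :
    IsCompact {γ : ProbabilityMeasure (M × M) | IsPlan μ₀ μ₁ (γ : Measure (M × M))} := by
  let ν₀ : ProbabilityMeasure M := ⟨μ₀, inferInstance⟩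
  let ν₁ : ProbabilityMeasure M := ⟨μ₁, inferInstance⟩
  have h₀ : IsClosed {γ : ProbabilityMeasure (M × M) |
      γ.map continuous_fst.measurable.aemeasurable = ν₀} :=
    isClosed_eq (ProbabilityMeasure.continuous_map continuous_fst) continuous_const
  have h₁ : IsClosed {γ : ProbabilityMeasure (M × M) |
      γ.map continuous_snd.measurable.aemeasurable = ν₁} :=
    isClosed_eq (ProbabilityMeasure.continuous_map continuous_snd) continuous_const
  convert (h₀.inter h₁).isCompact using 1
  ext γ
  simp only [IsPlan, mem_ofPred_eq, mem_inter_iff]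
  exact (and_iff_right γ.2).trans (and_congr
    (Subtype.ext_iff (a1 := γ.map continuous_fst.measurable.aemeasurable) (a2 := ν₀)).symm
    (Subtype.ext_iff (a1 := γ.map continuous_snd.measurable.aemeasurable) (a2 := ν₁)).symm)

/-- Existence of an optimal transfer plan: the set of transport plans is
nonempty (it contains the product measure), and the infimum of the total cost
over transport plans is attained. -/
theorem optimal_plan_exists {M : Type*} [MetricSpace M] [CompactSpace M]
    [Nonempty M] [MeasurableSpace M] [BorelSpace M]
    (c : M → M → ℝ) (hc : Continuous fun p : M × M => c p.1 p.2)
    (μ₀ μ₁ : Measure M) [IsProbabilityMeasure μ₀] [IsProbabilityMeasure μ₁] :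
    IsPlan μ₀ μ₁ (μ₀.prod μ₁) ∧
    ∃ γ : Measure (M × M), IsPlan μ₀ μ₁ γ ∧
      ∀ γ' : Measure (M × M), IsPlan μ₀ μ₁ γ' →
        (∫ p, c p.1 p.2 ∂γ) ≤ ∫ p, c p.1 p.2 ∂γ' := by
  refine ⟨isPlan_prod μ₀ μ₁, ?_⟩
  obtain ⟨γ, hγ, hmin⟩ := (isCompact_setOf_isPlan μ₀ μ₁).exists_isMinOn
    ⟨⟨μ₀.prod μ₁, inferInstance⟩, isPlan_prod μ₀ μ₁⟩
    (continuous_integral_probabilityMeasure hc).continuousOn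
  exact ⟨γ, hγ, fun γ' hγ' => isMinOn_iff.mp hmin ⟨γ', hγ'.1⟩ hγ'⟩
end
end
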